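/- arXiv:1903.00845 — 2 statements merged into one kernel-verified Lean document; each statement's English description precedes it below -/
import Mathlib

section
/- There exist i₀ ≥ 1 and constants 0 < c ≤ C such that for all i ≥ i₀, writing Q = P_1·P_3·⋯·P_{2i−1} and ρ_i = (c_2·c_4·⋯·c_{2i})/(c_1·c_3·⋯·c_{2i−1}), one has c·ρ_i ≤ ‖Q e₇‖/‖Q e₈‖ ≤ C·ρ_i, where ‖·‖ is the Euclidean norm on ℝ⁹. -/
open Filter Finset Matrix

/-- The golden ratio φ = (1+√5)/2. -/
noncomputable def goldphi : ℝ := (1 + Real.sqrt 5) / 2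

/-- The matrix `A`: identity in rows 1–7, row 8 = (0,0,0,0,0,1,1,1,1),
row 9 = (0,0,0,1,1,2,0,1,2). -/
def Amat : Matrix (Fin 9) (Fin 9) ℝ :=
  !![1,0,0,0,0,0,0,0,0;
     0,1,0,0,0,0,0,0,0;
     0,0,1,0,0,0,0,0,0;
     0,0,0,1,0,0,0,0,0;
     0,0,0,0,1,0,0,0,0;
     0,0,0,0,0,1,0,0,0;
     0,0,0,0,0,0,1,0,0;
     0,0,0,0,0,1,1,1,1;
     0,0,0,1,1,2,0,1,2]

/-- The matrix `M` with rows e₆, e₉, e₈, e₂, e₄+e₅, e₇, e₁+e₃, e₃, e₄. -/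
def Mmat : Matrix (Fin 9) (Fin 9) ℝ :=
  !![0,0,0,0,0,1,0,0,0;
     0,0,0,0,0,0,0,0,1;
     0,0,0,0,0,0,0,1,0;
     0,1,0,0,0,0,0,0,0;
     0,0,0,1,1,0,0,0,0;
     0,0,0,0,0,0,1,0,0;
     1,0,1,0,0,0,0,0,0;
     0,0,1,0,0,0,0,0,0;
     0,0,0,1,0,0,0,0,0]

/-- The rank-one limit matrix `L`, nonzero only in rows 2 and 3. -/
noncomputable def Lmat : Matrix (Fin 9) (Fin 9) ℝ :=
  !![0,0,0,0,0,0,0,0,0;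
     (Real.sqrt 5 - 1)/4, 1/2, (1 + Real.sqrt 5)/4, (3 + Real.sqrt 5)/4, 1/2, 0, (3 + Real.sqrt 5)/4, 0, 0;
     (3 - Real.sqrt 5)/4, (Real.sqrt 5 - 1)/4, 1/2, (1 + Real.sqrt 5)/4, (Real.sqrt 5 - 1)/4, 0, (1 + Real.sqrt 5)/4, 0, 0;
     0,0,0,0,0,0,0,0,0;
     0,0,0,0,0,0,0,0,0;
     0,0,0,0,0,0,0,0,0;
     0,0,0,0,0,0,0,0,0;
     0,0,0,0,0,0,0,0,0;
     0,0,0,0,0,0,0,0,0]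

/-- `a_i = r_i - 1`. -/
def aseq (r : ℕ → ℕ) (i : ℕ) : ℕ := r i - 1

/-- `c_i = (2/√5)·φ^{2 a_i}`. -/
noncomputable def cseq (r : ℕ → ℕ) (i : ℕ) : ℝ :=
  (2 / Real.sqrt 5) * goldphi ^ (2 * aseq r i)

/-- `P_i = A^{a_i} M A^{a_{i+1}} M`. -/
noncomputable def Pmat (r : ℕ → ℕ) (i : ℕ) : Matrix (Fin 9) (Fin 9) ℝ :=
  Amat ^ (aseq r i) * Mmat * Amat ^ (aseq r (i+1)) * Mmat

/-- `R_i = P_i / c_{i+1}`. -/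
noncomputable def Rmat (r : ℕ → ℕ) (i : ℕ) : Matrix (Fin 9) (Fin 9) ℝ :=
  (cseq r (i+1))⁻¹ • Pmat r i

/-- The Frobenius norm of a square real matrix. -/
noncomputable def frobNorm {n : ℕ} (X : Matrix (Fin n) (Fin n) ℝ) : ℝ :=
  Real.sqrt (∑ i, ∑ j, (X i j)^2)

/-- The hypotheses on the sequence `r`: `r 1 = 1`, `r 2 = 2`, and the sequence of
differences `n ↦ r (n+1) - r n` (for `n ≥ 1`) is strictly increasing. -/
def GoodSeq (r : ℕ → ℕ) : Prop :=
  r 1 = 1 ∧ r 2 = 2 ∧ ∀ n, 1 ≤ n → r (n+1) - r n < r (n+2) - r (n+1)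

/-- The Euclidean norm on ℝ⁹. -/
noncomputable def eNorm (u : Fin 9 → ℝ) : ℝ := Real.sqrt (∑ k, (u k)^2)

set_option autoImplicit false
set_option linter.unusedSectionVars false

/-! ### Fibonacci-type scalars -/

noncomputable def zq (n : ℕ) : ℝ := ((goldphi ^ 2)⁻¹) ^ n
noncomputable def cq (n : ℕ) : ℝ := (2 / Real.sqrt 5) * goldphi ^ (2 * n)
noncomputable def fq (n : ℕ) : ℝ := cq n / 2 - zq n / Real.sqrt 5
noncomputable def gq (n : ℕ) : ℝ := goldphi * fq n + zq n

lemma sqrt5_sq : Real.sqrt 5 * Real.sqrt 5 = 5 := Real.mul_self_sqrt (by norm_num)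

lemma sqrt5_lo : (2.2 : ℝ) < Real.sqrt 5 := by
  apply Real.lt_sqrt_of_sq_lt; norm_num

lemma sqrt5_hi : Real.sqrt 5 < (2.3 : ℝ) := by
  rw [Real.sqrt_lt' (by norm_num)]; norm_num

lemma phi_sq : goldphi ^ 2 = goldphi + 1 := by
  have := sqrt5_sq
  unfold goldphi; nlinarith

lemma phi_lo : (1.6 : ℝ) < goldphi := by
  have := sqrt5_lo
  unfold goldphi; linarith

lemma phi_hi : goldphi < (1.7 : ℝ) := by
  have := sqrt5_hi
  unfold goldphi; linarith

lemma phi_inv : (goldphi ^ 2)⁻¹ = 2 - goldphi := by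
  have h := phi_sq
  have h1 := phi_lo
  rw [inv_eq_iff_eq_inv, eq_comm, inv_eq_iff_eq_inv, eq_comm]
  apply inv_eq_of_mul_eq_one_left
  rw [h]; nlinarith

lemma sqrt5_eq : Real.sqrt 5 = 2 * goldphi - 1 := by unfold goldphi; ring

lemma fq_succ (n : ℕ) : fq (n+1) = fq n + gq n := by
  have h := phi_sq
  have h5 := sqrt5_lo
  have h5' := sqrt5_sq
  have e1 : cq (n+1) = (goldphi + 1) * cq n := by
    unfold cq; rw [← h]; ring
  have e2 : zq (n+1) = (2 - goldphi) * zq n := by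
    unfold zq; rw [← phi_inv]; ring
  have key : zq n = (zq n / Real.sqrt 5) * (2 * goldphi - 1) := by
    rw [← sqrt5_eq]; field_simp
  unfold gq fq
  rw [e1, e2, mul_div_assoc (2 - goldphi)]
  linear_combination -key

lemma gq_succ (n : ℕ) : gq (n+1) = fq n + 2 * gq n := by
  have h := phi_sq
  have e2 : zq (n+1) = (2 - goldphi) * zq n := by
    unfold zq; rw [← phi_inv]; ring
  have e3 : gq (n+1) = goldphi * fq (n+1) + zq (n+1) := rfl
  rw [e3, fq_succ, e2]
  unfold gq
  linear_combination (fq n) * h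

lemma zq_pos (n : ℕ) : 0 < zq n := by
  have := phi_lo
  unfold zq; positivity

lemma zq_le (n : ℕ) : zq n ≤ 1 := by
  have := phi_lo
  have := phi_hi
  unfold zq
  rw [phi_inv]
  exact pow_le_one₀ (by linarith) (by linarith)

lemma fg_zero : fq 0 = 0 ∧ gq 0 = 1 := by
  have : fq 0 = 0 := by simp [fq, cq, zq]; ring
  refine ⟨this, ?_⟩
  simp [gq, this, zq]

lemma fg_nonneg (n : ℕ) : 0 ≤ fq n ∧ fq n + 1 ≤ gq n := by
  induction n with
  | zero => rw [fg_zero.1, fg_zero.2]; norm_num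
  | succ k ih =>
    rw [fq_succ, gq_succ]
    constructor <;> linarith [ih.1, ih.2]

lemma g_ge_two_f (n : ℕ) : gq n ≤ 2 * fq n + 1 := by
  induction n with
  | zero => rw [fg_zero.1, fg_zero.2]; norm_num
  | succ k ih =>
    rw [fq_succ, gq_succ]
    linarith [fg_nonneg k]

lemma fq_bounds (n : ℕ) : fq n ≤ cq n / 2 ∧ cq n / 2 - 1 / 2 ≤ fq n := by
  have h1 := zq_pos n
  have h2 := zq_le n
  have h5 := sqrt5_lo
  have : zq n / Real.sqrt 5 ≤ 1 / 2 := by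
    rw [div_le_div_iff₀ (by linarith) (by norm_num)]; linarith
  have h3 : 0 ≤ zq n / Real.sqrt 5 := by positivity
  unfold fq
  constructor <;> linarith

lemma cq_ge (n : ℕ) : 1/2 ≤ cq n := by
  have h5 := sqrt5_lo
  have h6 := sqrt5_hi
  have : (1:ℝ)/2 ≤ 2 / Real.sqrt 5 := by
    rw [div_le_div_iff₀ (by norm_num) (by linarith)]; linarith
  have h1 : 1 ≤ goldphi ^ (2*n) := one_le_pow₀ (by linarith [phi_lo])
  unfold cq
  nlinarith

lemma cq_mono {m n : ℕ} (h : m + 1 ≤ n) : 2 * cq m ≤ cq n := by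
  obtain ⟨k, rfl⟩ := Nat.exists_eq_add_of_le h
  have h1 : 1 ≤ goldphi ^ (2*k) := one_le_pow₀ (by linarith [phi_lo])
  have e : cq (m + 1 + k) = cq m * (goldphi ^ 2 * goldphi ^ (2*k)) := by
    unfold cq; ring
  have h2 : 2 ≤ goldphi ^ 2 * goldphi ^ (2*k) := by
    have := phi_sq
    have := phi_lo
    nlinarith
  rw [e]
  have := cq_ge m
  nlinarith

/-! ### Row vectors times A^n and M -/

lemma vec_A (v : Fin 9 → ℝ) : v ᵥ* Amat = ![v 0, v 1, v 2, v 3 + v 8, v 4 + v 8,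
    v 5 + v 7 + 2 * v 8, v 6 + v 7, v 7 + v 8, v 7 + 2 * v 8] := by
  ext j
  fin_cases j <;> simp [Matrix.vecMul, dotProduct, Fin.sum_univ_succ, Amat] <;> ring

lemma vec_M (v : Fin 9 → ℝ) : v ᵥ* Mmat = ![v 6, v 3, v 6 + v 7, v 4 + v 8, v 4,
    v 0, v 5, v 2, v 1] := by
  ext j
  fin_cases j <;> simp [Matrix.vecMul, dotProduct, Fin.sum_univ_succ, Mmat]

lemma vec_An (v : Fin 9 → ℝ) (n : ℕ) : v ᵥ* Amat ^ n = ![v 0, v 1, v 2,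
    v 3 + (gq n - fq n - 1) * v 7 + fq n * v 8,
    v 4 + (gq n - fq n - 1) * v 7 + fq n * v 8,
    v 5 + (gq n - 1) * v 7 + (fq n + gq n - 1) * v 8,
    v 6 + (2 * fq n - gq n + 1) * v 7 + (gq n - fq n - 1) * v 8,
    (gq n - fq n) * v 7 + fq n * v 8,
    fq n * v 7 + gq n * v 8] := by
  induction n with
  | zero =>
    rw [fg_zero.1, fg_zero.2]
    ext j
    fin_cases j <;> simp
  | succ k ih =>
    rw [pow_succ, ← Matrix.vecMul_vecMul, ih, vec_A, fq_succ, gq_succ]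
    ext j
    fin_cases j <;> simp <;> ring

lemma vec_P (v : Fin 9 → ℝ) (a b : ℕ) : v ᵥ* (Amat ^ a * Mmat * Amat ^ b * Mmat) = 
   ![v 5 + (gq a - 1) * v 7 + (fq a + gq a - 1) * v 8 + (2 * fq b - gq b + 1) * v 2
        + (gq b - fq b - 1) * v 1,
     v 4 + (gq a - 1) * v 7 + (fq a + gq a) * v 8 + (gq b - fq b - 1) * v 2 + fq b * v 1,
     v 5 + (gq a - 1) * v 7 + (fq a + gq a - 1) * v 8 + (fq b + 1) * v 2 + (gq b - 1) * v 1,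
     v 4 + (gq a - fq a - 1) * v 7 + fq a * v 8 + (gq b - 1) * v 2 + (fq b + gq b) * v 1,
     v 4 + (gq a - fq a - 1) * v 7 + fq a * v 8 + (gq b - fq b - 1) * v 2 + fq b * v 1,
     v 6 + (2 * fq a - gq a + 1) * v 7 + (gq a - fq a - 1) * v 8,
     v 0 + (gq b - 1) * v 2 + (fq b + gq b - 1) * v 1,
     v 6 + (fq a + 1) * v 7 + (gq a - 1) * v 8,
     v 3 + (gq a - fq a - 1) * v 7 + fq a * v 8] := by
  rw [← Matrix.vecMul_vecMul, ← Matrix.vecMul_vecMul, ← Matrix.vecMul_vecMul, vec_An v, vec_M,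
    vec_An, vec_M]
  ext j
  fin_cases j <;> simp <;> ring

/-! ### One-step inequalities -/

noncomputable def sF (v : Fin 9 → ℝ) : ℝ := v 7 + goldphi * v 8
noncomputable def tF (v : Fin 9 → ℝ) : ℝ := goldphi * v 1 + v 2
noncomputable def zF (v : Fin 9 → ℝ) : ℝ := v 0 + v 3 + v 4 + v 5 + v 6

lemma core_upper (x y : ℝ) (hx : 0 ≤ x) (hy : 0 ≤ y) (n : ℕ) :
    (2 * fq n + 1 - goldphi + goldphi * zq n) * x + (2 * goldphi * fq n + zq n - 1) * y
      ≤ (cq n + 2) * (x + goldphi * y) := by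
  have h1 := zq_pos n
  have h2 := zq_le n
  have h3 := (fq_bounds n).1
  have h4 := phi_lo
  have h5 := phi_hi
  have e1 : (2 * fq n + 1 - goldphi + goldphi * zq n) ≤ cq n + 2 := by nlinarith
  have e2 : (2 * goldphi * fq n + zq n - 1) ≤ (cq n + 2) * goldphi := by nlinarith
  nlinarith [mul_le_mul_of_nonneg_right e1 hx, mul_le_mul_of_nonneg_right e2 hy]

lemma core_lower (x y : ℝ) (hx : 0 ≤ x) (hy : 0 ≤ y) (n : ℕ) :
    (cq n - 2) * (x + goldphi * y) ≤
    (2 * fq n + 1 - goldphi + goldphi * zq n) * x + (2 * goldphi * fq n + zq n - 1) * y := by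
  have h1 := zq_pos n
  have h2 := zq_le n
  have h3 := (fq_bounds n).2
  have h4 := phi_lo
  have h5 := phi_hi
  have e1 : cq n - 2 ≤ (2 * fq n + 1 - goldphi + goldphi * zq n) := by nlinarith
  have e2 : (cq n - 2) * goldphi ≤ (2 * goldphi * fq n + zq n - 1) := by nlinarith
  nlinarith [mul_le_mul_of_nonneg_right e1 hx, mul_le_mul_of_nonneg_right e2 hy]


lemma s_eq (v : Fin 9 → ℝ) (a b : ℕ) : sF (v ᵥ* (Amat ^ a * Mmat * Amat ^ b * Mmat)) =
    (2 * fq a + 1 - goldphi + goldphi * zq a) * v 7 + (2 * goldphi * fq a + zq a - 1) * v 8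
      + (v 6 + goldphi * v 3) := by
  rw [vec_P]
  simp only [sF]
  have h := phi_sq
  simp [gq]
  linear_combination (fq a * v 7) * h

lemma t_eq (v : Fin 9 → ℝ) (a b : ℕ) : tF (v ᵥ* (Amat ^ a * Mmat * Amat ^ b * Mmat)) =
    (2 * fq b + 1 - goldphi + goldphi * zq b) * v 2 + (2 * goldphi * fq b + zq b - 1) * v 1
      + (goldphi * (v 4 + (gq a - 1) * v 7 + (fq a + gq a) * v 8) +
        (v 5 + (gq a - 1) * v 7 + (fq a + gq a - 1) * v 8)) := by
  rw [vec_P]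
  simp only [tF]
  have h := phi_sq
  have e : gq b = goldphi * fq b + zq b := rfl
  simp [e]
  linear_combination (fq b * v 2) * h


lemma s_upper (v : Fin 9 → ℝ) (hv : ∀ j, 0 ≤ v j) (a b : ℕ) : sF (v ᵥ* (Amat ^ a * Mmat * Amat ^ b * Mmat)) ≤
    (cq a + 2) * sF v + 2 * zF v := by
  rw [s_eq]
  have h := core_upper (v 7) (v 8) (hv 7) (hv 8) a
  have := phi_hi
  have := hv 0; have := hv 3; have := hv 4; have := hv 5; have := hv 6
  simp only [sF, zF]
  nlinarith

lemma s_lower (v : Fin 9 → ℝ) (hv : ∀ j, 0 ≤ v j) (a b : ℕ) : (cq a - 2) * sF v ≤ sF (v ᵥ* (Amat ^ a * Mmat * Amat ^ b * Mmat)) := by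
  rw [s_eq]
  have h := core_lower (v 7) (v 8) (hv 7) (hv 8) a
  have := phi_lo
  have := hv 3; have := hv 6
  simp only [sF]
  nlinarith

lemma t_lower (v : Fin 9 → ℝ) (hv : ∀ j, 0 ≤ v j) (a b : ℕ) : (cq b - 2) * tF v ≤ tF (v ᵥ* (Amat ^ a * Mmat * Amat ^ b * Mmat)) := by
  rw [t_eq]
  have h := core_lower (v 2) (v 1) (hv 2) (hv 1) b
  have := phi_lo
  have := fg_nonneg a
  have : 0 ≤ goldphi * (v 4 + (gq a - 1) * v 7 + (fq a + gq a) * v 8) +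
        (v 5 + (gq a - 1) * v 7 + (fq a + gq a - 1) * v 8) := by
    have := hv 4; have := hv 5; have := hv 7; have := hv 8
    have : 0 ≤ gq a - 1 := by linarith
    have : 0 ≤ fq a + gq a := by linarith
    have : 0 ≤ fq a + gq a - 1 := by linarith
    positivity
  simp only [tF]
  linarith

lemma t_upper (v : Fin 9 → ℝ) (hv : ∀ j, 0 ≤ v j) (a b : ℕ) : tF (v ᵥ* (Amat ^ a * Mmat * Amat ^ b * Mmat)) ≤
    (cq b + 2) * tF v + 100 * (zF v + cq a * sF v) := by
  rw [t_eq]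
  have h := core_upper (v 2) (v 1) (hv 2) (hv 1) b
  have hp := phi_lo
  have hp' := phi_hi
  have hn := fg_nonneg a
  have hg := g_ge_two_f a
  have hf := fq_bounds a
  have hc := cq_ge a
  have g1 : (gq a - 1) * v 7 ≤ (10 * cq a) * v 7 := mul_le_mul_of_nonneg_right (by linarith) (hv 7)
  have g2 : (fq a + gq a) * v 8 ≤ (10 * cq a) * v 8 :=
    mul_le_mul_of_nonneg_right (by linarith) (hv 8)
  have k7 : 0 ≤ cq a * v 7 := mul_nonneg (by linarith) (hv 7)
  have k8 : 0 ≤ cq a * v 8 := mul_nonneg (by linarith) (hv 8)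
  have k8' : cq a * v 8 ≤ goldphi * (cq a * v 8) := by nlinarith
  have h0 := hv 0; have h3 := hv 3; have h4 := hv 4; have h5 := hv 5; have h6 := hv 6
  have h8 := hv 8
  have m : goldphi * (v 4 + (gq a - 1) * v 7 + (fq a + gq a) * v 8) ≤
      2 * (v 4 + 10 * (cq a * v 7) + 10 * (cq a * v 8)) := by
    have : 0 ≤ v 4 + 10 * (cq a * v 7) + 10 * (cq a * v 8) := by positivity
    calc _ ≤ goldphi * (v 4 + 10 * (cq a * v 7) + 10 * (cq a * v 8)) := by
          apply mul_le_mul_of_nonneg_left _ (by linarith); linarith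
      _ ≤ _ := mul_le_mul_of_nonneg_right (by linarith) this
  simp only [tF, zF, sF]
  linarith

lemma z_upper (v : Fin 9 → ℝ) (hv : ∀ j, 0 ≤ v j) (a b : ℕ) : zF (v ᵥ* (Amat ^ a * Mmat * Amat ^ b * Mmat)) ≤
    100 * (cq b * tF v + zF v + cq a * sF v) := by
  rw [vec_P]
  have hp := phi_lo
  have hna := fg_nonneg a
  have hga := g_ge_two_f a
  have hfa := fq_bounds a
  have hca := cq_ge a
  have hnb := fg_nonneg b
  have hgb := g_ge_two_f b
  have hfb := fq_bounds b
  have hcb := cq_ge b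
  have A : ∀ k y : ℝ, 0 ≤ y → k ≤ 3 * cq a + 1 → k * y ≤ 10 * (cq a * y) := by
    intro k y hy hk
    calc k * y ≤ (10 * cq a) * y := mul_le_mul_of_nonneg_right (by linarith) hy
      _ = _ := by ring
  have B : ∀ k y : ℝ, 0 ≤ y → k ≤ 3 * cq b + 1 → k * y ≤ 10 * (cq b * y) := by
    intro k y hy hk
    calc k * y ≤ (10 * cq b) * y := mul_le_mul_of_nonneg_right (by linarith) hy
      _ = _ := by ring
  have k7 : 0 ≤ cq a * v 7 := mul_nonneg (by linarith) (hv 7)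
  have k8 : 0 ≤ cq a * v 8 := mul_nonneg (by linarith) (hv 8)
  have k8' : cq a * v 8 ≤ goldphi * (cq a * v 8) := by nlinarith
  have k2 : 0 ≤ cq b * v 2 := mul_nonneg (by linarith) (hv 2)
  have k1 : 0 ≤ cq b * v 1 := mul_nonneg (by linarith) (hv 1)
  have k1' : cq b * v 1 ≤ goldphi * (cq b * v 1) := by nlinarith
  have h0 := hv 0; have h3 := hv 3; have h4 := hv 4; have h5 := hv 5; have h6 := hv 6
  have a1 := A (gq a - 1) (v 7) (hv 7) (by linarith)
  have a2 := A (fq a + gq a - 1) (v 8) (hv 8) (by linarith)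
  have a3 := A (gq a - fq a - 1) (v 7) (hv 7) (by linarith)
  have a4 := A (fq a) (v 8) (hv 8) (by linarith)
  have a5 := A (2 * fq a - gq a + 1) (v 7) (hv 7) (by linarith)
  have a6 := A (gq a - fq a - 1) (v 8) (hv 8) (by linarith)
  have b1 := B (2 * fq b - gq b + 1) (v 2) (hv 2) (by linarith)
  have b2 := B (gq b - fq b - 1) (v 1) (hv 1) (by linarith)
  have b3 := B (gq b - 1) (v 2) (hv 2) (by linarith)
  have b4 := B (fq b + gq b) (v 1) (hv 1) (by linarith)
  have b5 := B (gq b - fq b - 1) (v 2) (hv 2) (by linarith)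
  have b6 := B (fq b) (v 1) (hv 1) (by linarith)
  have b7 := B (fq b + gq b - 1) (v 1) (hv 1) (by linarith)
  simp [tF, zF, sF]
  linarith

lemma six_lower (v : Fin 9 → ℝ) (hv : ∀ j, 0 ≤ v j) (a b : ℕ) (hb : 4 ≤ cq b) :
    cq b / 10 * tF v ≤ (v ᵥ* (Amat ^ a * Mmat * Amat ^ b * Mmat)) 6 := by
  rw [vec_P]
  have hp := phi_lo
  have hp' := phi_hi
  have hz := zq_pos b
  have hnb := fg_nonneg b
  have hfb := fq_bounds b
  have hg : 1.6 * fq b ≤ gq b := by unfold gq; nlinarith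
  have e1 := mul_le_mul_of_nonneg_right (show cq b / 10 ≤ gq b - 1 by linarith) (hv 2)
  have e2 := mul_le_mul_of_nonneg_right
    (show cq b / 10 * goldphi ≤ fq b + gq b - 1 by nlinarith) (hv 1)
  have := hv 0
  simp [tF]
  linarith

lemma seven_lower (v : Fin 9 → ℝ) (hv : ∀ j, 0 ≤ v j) (a b : ℕ) (ha : 4 ≤ cq a) :
    cq a / 10 * sF v ≤ (v ᵥ* (Amat ^ a * Mmat * Amat ^ b * Mmat)) 7 := by
  rw [vec_P]
  have hp := phi_lo
  have hp' := phi_hi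
  have hz := zq_pos a
  have hnb := fg_nonneg a
  have hfb := fq_bounds a
  have hg : 1.6 * fq a ≤ gq a := by unfold gq; nlinarith
  have e1 := mul_le_mul_of_nonneg_right (show cq a / 10 ≤ fq a + 1 by linarith) (hv 7)
  have e2 := mul_le_mul_of_nonneg_right
    (show cq a / 10 * goldphi ≤ gq a - 1 by nlinarith) (hv 8)
  have := hv 6
  simp [sF]
  linarith

lemma seven_mono (v : Fin 9 → ℝ) (hv : ∀ j, 0 ≤ v j) (a b : ℕ) : v 7 ≤ (v ᵥ* (Amat ^ a * Mmat * Amat ^ b * Mmat)) 7 := by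
  rw [vec_P]
  have hn := fg_nonneg a
  have := mul_nonneg hn.1 (hv 7)
  have := mul_nonneg (show 0 ≤ gq a - 1 by linarith) (hv 8)
  have := hv 6
  simp
  linarith

lemma two_mono (v : Fin 9 → ℝ) (hv : ∀ j, 0 ≤ v j) (a b : ℕ) : v 2 ≤ (v ᵥ* (Amat ^ a * Mmat * Amat ^ b * Mmat)) 2 := by
  rw [vec_P]
  have hn := fg_nonneg a
  have hn' := fg_nonneg b
  have := mul_nonneg hn'.1 (hv 2)
  have := mul_nonneg (show 0 ≤ gq b - 1 by linarith) (hv 1)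
  have := mul_nonneg (show 0 ≤ gq a - 1 by linarith) (hv 7)
  have := mul_nonneg (show 0 ≤ fq a + gq a - 1 by linarith) (hv 8)
  have := hv 5
  simp
  linarith



/-! ### Abstract sequence lemmas -/

lemma sum_half (n : ℕ) : ∑ i ∈ Finset.range n, (1/2 : ℝ) ^ i = 2 - 2 * (1/2) ^ n := by
  induction n with
  | zero => simp
  | succ k ih => rw [Finset.sum_range_succ, ih]; ring

lemma bdd_of_rec (w : ℕ → ℝ) (K : ℝ) (hK : 0 ≤ K) (hw : ∀ i, 0 ≤ w i)
    (h : ∀ i, w (i+1) ≤ (1 + K * (1/2)^i) * w i) : ∃ W, 0 < W ∧ ∀ i, w i ≤ W := by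
  have key : ∀ n, w n ≤ Real.exp (K * ∑ i ∈ Finset.range n, (1/2 : ℝ) ^ i) * w 0 := by
    intro n
    induction n with
    | zero => simp
    | succ k ih =>
      rw [Finset.sum_range_succ, mul_add, Real.exp_add]
      have e := Real.add_one_le_exp (K * (1/2)^k)
      calc w (k+1) ≤ (1 + K * (1/2)^k) * w k := h k
        _ ≤ Real.exp (K * (1/2)^k) * w k := mul_le_mul_of_nonneg_right (by linarith) (hw k)
        _ ≤ Real.exp (K * (1/2)^k) * (Real.exp (K * ∑ i ∈ Finset.range k, (1/2 : ℝ) ^ i) * w 0) :=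
          mul_le_mul_of_nonneg_left ih (Real.exp_pos _).le
        _ = _ := by ring
  refine ⟨Real.exp (K * 2) * w 0 + 1, by have := hw 0; positivity, fun n => ?_⟩
  have h1 : Real.exp (K * ∑ i ∈ Finset.range n, (1/2 : ℝ) ^ i) ≤ Real.exp (K * 2) := by
    apply Real.exp_le_exp.mpr
    apply mul_le_mul_of_nonneg_left _ hK
    rw [sum_half]
    have : (0:ℝ) < (1/2)^n := by positivity
    linarith
  have := key n
  have := mul_le_mul_of_nonneg_right h1 (hw 0)
  linarith

lemma pos_of_rec (w : ℕ → ℝ) (K : ℝ) (hK : 0 ≤ K) (hw : ∀ i, 0 < w i)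
    (h : ∀ i, (1 - K * (1/2)^i) * w i ≤ w (i+1)) :
    ∃ m, 0 < m ∧ ∃ i₀, ∀ i, i₀ ≤ i → m ≤ w i := by
  obtain ⟨N, hN⟩ := exists_pow_lt_of_lt_one (show (0:ℝ) < 1 / (4 * (K + 1)) by positivity)
    (show (1/2 : ℝ) < 1 by norm_num)
  have hKN : K * (1/2)^N ≤ 1/4 := by
    have h1 : (1/2:ℝ)^N * (4 * (K+1)) < 1 := by
      rwa [lt_div_iff₀ (by positivity)] at hN
    have : (0:ℝ) < (1/2)^N := by positivity
    nlinarith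
  have key : ∀ n, (1 - K * (1/2)^N * (2 - 2 * (1/2)^n)) * w N ≤ w (N + n) := by
    intro n
    induction n with
    | zero => simp
    | succ k ih =>
      have hx := h (N + k)
      have p1 : (0:ℝ) < (1/2)^N := by positivity
      have p2 : (0:ℝ) < (1/2)^k := by positivity
      have p3 : (1/2:ℝ)^k ≤ 1 := pow_le_one₀ (by norm_num) (by norm_num)
      rw [pow_add] at hx
      rw [pow_succ]
      set e := K * (1/2)^N with he
      have e0 : 0 ≤ e := by positivity
      have hx' : (1 - e * (1/2)^k) * w (N+k) ≤ w (N + (k+1)) := by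
        rw [he]; rw [← add_assoc]; linarith
      refine le_trans ?_ hx'
      have q : 0 ≤ 1 - e * (1/2)^k := by nlinarith
      refine le_trans ?_ (mul_le_mul_of_nonneg_left ih q)
      rw [← mul_assoc (1 - e * (1/2)^k)]
      apply mul_le_mul_of_nonneg_right _ (hw N).le
      have : 0 ≤ (e * (1/2)^k) * (e * (2 - 2 * (1/2)^k)) := by
        apply mul_nonneg (by positivity)
        apply mul_nonneg e0; linarith
      nlinarith
  refine ⟨w N / 2, by have := hw N; positivity, N, fun i hi => ?_⟩
  obtain ⟨n, rfl⟩ := Nat.exists_eq_add_of_le hi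
  refine le_trans ?_ (key n)
  have p2 : (0:ℝ) < (1/2)^n := by positivity
  have p1 : (0:ℝ) < (1/2)^N := by positivity
  have : 0 ≤ K * (1/2)^N := by positivity
  have : 1/2 ≤ (1 - K * (1/2)^N * (2 - 2 * (1/2)^n)) := by nlinarith
  nlinarith [hw N]


noncomputable def pr (u : ℕ → ℝ) (i : ℕ) : ℝ := ∏ l ∈ Finset.range i, u l

lemma pr_succ (u : ℕ → ℝ) (i : ℕ) : pr u (i+1) = pr u i * u i := Finset.prod_range_succ _ _

lemma pr_pos (u : ℕ → ℝ) (h : ∀ i, 1/2 ≤ u i) (i : ℕ) : 0 < pr u i :=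
  Finset.prod_pos fun l _ => by linarith [h l]


lemma u_ge (u w : ℕ → ℝ) (hu : ∀ i, 1/2 ≤ u i) (hw : ∀ i, 1/2 ≤ w i)
    (huw : ∀ i, 2 * u i ≤ w i) (hwu : ∀ i, 2 * w i ≤ u (i+1)) (i : ℕ) : 1 / u i ≤ 2 * (1/2)^i := by
  have : ∀ i, 1 ≤ (2 * (1/2)^i) * u i := by
    intro i
    induction i with
    | zero => have := hu 0; simp; linarith
    | succ k ih =>
      rw [pow_succ]
      have p : (0:ℝ) < (1/2)^k := by positivity
      have : 4 * u k ≤ u (k+1) := by linarith [huw k, hwu k]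
      nlinarith [hu k]
  rw [div_le_iff₀ (by linarith [hu i])]
  exact this i

lemma w_ge (u w : ℕ → ℝ) (hu : ∀ i, 1/2 ≤ u i) (hw : ∀ i, 1/2 ≤ w i)
    (huw : ∀ i, 2 * u i ≤ w i) (hwu : ∀ i, 2 * w i ≤ u (i+1)) (i : ℕ) : 1 / w i ≤ 2 * (1/2)^i := by
  refine le_trans ?_ (u_ge u w hu hw huw hwu i)
  apply one_div_le_one_div_of_le (by linarith [hu i])
  linarith [huw i, hu i]

lemma DC (u w : ℕ → ℝ) (hu : ∀ i, 1/2 ≤ u i) (hw : ∀ i, 1/2 ≤ w i)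
    (huw : ∀ i, 2 * u i ≤ w i) (hwu : ∀ i, 2 * w i ≤ u (i+1)) (i : ℕ) : pr u i ≤ (1/2)^i * pr w i := by
  induction i with
  | zero => simp [pr]
  | succ k ih =>
    rw [pr_succ, pr_succ, pow_succ]
    calc pr u k * u k ≤ ((1/2)^k * pr w k) * (w k / 2) :=
          mul_le_mul ih (by linarith [huw k]) (by linarith [hu k])
            (by have := pr_pos w hw k; positivity)
      _ = _ := by ring

lemma CD (u w : ℕ → ℝ) (hu : ∀ i, 1/2 ≤ u i) (hw : ∀ i, 1/2 ≤ w i)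
    (huw : ∀ i, 2 * u i ≤ w i) (hwu : ∀ i, 2 * w i ≤ u (i+1)) (i : ℕ) : pr w i ≤ 2 * (1/2)^i * pr u (i+1) := by
  induction i with
  | zero => have := hu 0; simp [pr]; linarith
  | succ k ih =>
    rw [pr_succ w, pr_succ u (k+1), pow_succ]
    have e : pr w k * w k ≤ (2 * (1/2)^k * pr u (k+1)) * (u (k+1) / 2) :=
          mul_le_mul ih (by linarith [hwu k]) (by linarith [hw k])
            (by have := pr_pos u hu (k+1); positivity)
    linarith

lemma abs_upper (u w : ℕ → ℝ) (hu : ∀ i, 1/2 ≤ u i) (hw : ∀ i, 1/2 ≤ w i)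
    (huw : ∀ i, 2 * u i ≤ w i) (hwu : ∀ i, 2 * w i ≤ u (i+1)) (s t z : ℕ → ℝ) (hs : ∀ i, 0 ≤ s i) (ht : ∀ i, 0 ≤ t i) (hz : ∀ i, 0 ≤ z i)
    (h1 : ∀ i, s (i+1) ≤ (u i + 2) * s i + 2 * z i)
    (h2 : ∀ i, t (i+1) ≤ (w i + 2) * t i + 100 * (z i + u i * s i))
    (h3 : ∀ i, z (i+1) ≤ 100 * (w i * t i + z i + u i * s i)) :
    ∃ W, 0 < W ∧ ∀ i, s i ≤ W * pr u i ∧ z (i+1) ≤ W * pr w (i+1) := by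
  have pu := pr_pos u hu
  have pw := pr_pos w hw
  set x : ℕ → ℝ := fun i => s i / pr u i with hx
  set y : ℕ → ℝ := fun i => t i / pr w i with hy
  set q : ℕ → ℝ := fun i => z i / pr w i with hq
  have sx : ∀ i, s i = x i * pr u i := fun i => by simp only [hx]; have := (pu i).ne'; field_simp
  have ty : ∀ i, t i = y i * pr w i := fun i => by simp only [hy]; have := (pw i).ne'; field_simp
  have zq' : ∀ i, z i = q i * pr w i := fun i => by simp only [hq]; have := (pw i).ne'; field_simp
  have x0 : ∀ i, 0 ≤ x i := fun i => div_nonneg (hs i) (pu i).le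
  have y0 : ∀ i, 0 ≤ y i := fun i => div_nonneg (ht i) (pw i).le
  have q0 : ∀ i, 0 ≤ q i := fun i => div_nonneg (hz i) (pw i).le
  have eu : ∀ i, 1 ≤ 2 * (1/2)^i * u i := fun i => by
    have := u_ge u w hu hw huw hwu i
    rwa [div_le_iff₀ (by linarith [hu i])] at this
  have ew : ∀ i, 1 ≤ 2 * (1/2)^i * w i := fun i => by
    have := w_ge u w hu hw huw hwu i
    rwa [div_le_iff₀ (by linarith [hw i])] at this
  set ε : ℕ → ℝ := fun i => 200 * (1/2)^i with hε
  have r1 : ∀ i, x (i+1) ≤ (1 + ε i) * x i + ε i * q i := by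
    intro i
    simp only [hx]
    rw [div_le_iff₀ (pu (i+1))]
    refine (h1 i).trans ?_
    change _ ≤ ((1 + ε i) * x i + ε i * q i) * _
    rw [sx, zq']
    have hc := mul_le_mul_of_nonneg_left (CD u w hu hw huw hwu i) (q0 i)
    have hp : (0:ℝ) < (1/2)^i := by positivity
    have hd := mul_le_mul_of_nonneg_left (eu i) (mul_nonneg (x0 i) (pu i).le)
    rw [pr_succ] at hc ⊢
    have n1 : 0 ≤ q i * ((1/2)^i * (pr u i * u i)) := by
      have := q0 i; have := pu i; have := hu i; positivity
    have n2 : 0 ≤ x i * pr u i * ((1/2)^i * u i) := by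
      have := x0 i; have := pu i; have := hu i; positivity
    simp only [hε]
    nlinarith
  have r2 : ∀ i, y (i+1) ≤ (1 + ε i) * y i + ε i * q i + ε i * x i := by
    intro i
    simp only [hy]
    rw [div_le_iff₀ (pw (i+1))]
    refine (h2 i).trans ?_
    change _ ≤ ((1 + ε i) * y i + ε i * q i + ε i * x i) * _
    rw [sx, zq', ty]
    have hc := mul_le_mul_of_nonneg_left (DC u w hu hw huw hwu (i+1)) (x0 i)
    have hp : (0:ℝ) < (1/2)^i := by positivity
    have hd := mul_le_mul_of_nonneg_left (ew i) (mul_nonneg (y0 i) (pw i).le)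
    have he := mul_le_mul_of_nonneg_left (ew i) (mul_nonneg (q0 i) (pw i).le)
    rw [pr_succ, pr_succ, pow_succ] at hc
    rw [pr_succ]
    have n1 : 0 ≤ x i * ((1/2)^i * (pr w i * w i)) := by
      have := x0 i; have := pw i; have := hw i; positivity
    have n2 : 0 ≤ y i * pr w i * ((1/2)^i * w i) := by
      have := y0 i; have := pw i; have := hw i; positivity
    simp only [hε]
    nlinarith
  have r3 : ∀ i, q (i+1) ≤ 100 * y i + ε i * q i + ε i * x i := by
    intro i
    simp only [hq]
    rw [div_le_iff₀ (pw (i+1))]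
    refine (h3 i).trans ?_
    change _ ≤ (100 * y i + ε i * q i + ε i * x i) * _
    rw [sx, zq', ty]
    have hc := mul_le_mul_of_nonneg_left (DC u w hu hw huw hwu (i+1)) (x0 i)
    have hp : (0:ℝ) < (1/2)^i := by positivity
    have he := mul_le_mul_of_nonneg_left (ew i) (mul_nonneg (q0 i) (pw i).le)
    rw [pr_succ, pr_succ, pow_succ] at hc
    rw [pr_succ]
    have n1 : 0 ≤ x i * ((1/2)^i * (pr w i * w i)) := by
      have := x0 i; have := pw i; have := hw i; positivity
    simp only [hε]
    nlinarith
  have ε0 : ∀ i, 0 ≤ ε i := fun i => by simp only [hε]; positivity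
  have ε1 : ∀ i, ε i ≤ 200 := fun i => by
    have : (1/2:ℝ)^i ≤ 1 := pow_le_one₀ (by norm_num) (by norm_num)
    simp only [hε]; linarith
  have εs : ∀ i, ε (i+1) ≤ ε i := fun i => by
    have hp : (0:ℝ) < (1/2)^i := by positivity
    simp only [hε, pow_succ]; linarith
  obtain ⟨W, W0, hW⟩ := bdd_of_rec (fun i => x i + y i + 2 * (ε i * q i)) 200000 (by norm_num)
    (fun i => by have := x0 i; have := y0 i; have := q0 i; have := ε0 i; positivity) (by
      intro i
      have e3 : ε (i+1) * q (i+1) ≤ ε i * (100 * y i + ε i * q i + ε i * x i) :=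
        mul_le_mul (εs i) (r3 i) (q0 _) (ε0 i)
      have a1 := r1 i
      have a2 := r2 i
      have hE : (200000:ℝ) * (1/2)^i = 1000 * ε i := by simp only [hε]; ring
      change x (i+1) + y (i+1) + 2 * (ε (i+1) * q (i+1)) ≤
        (1 + 200000 * (1/2)^i) * (x i + y i + 2 * (ε i * q i))
      rw [hE]
      have b1 : 0 ≤ ε i * x i := mul_nonneg (ε0 i) (x0 i)
      have b2 : 0 ≤ ε i * y i := mul_nonneg (ε0 i) (y0 i)
      have b3 : 0 ≤ ε i * q i := mul_nonneg (ε0 i) (q0 i)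
      have b4 : ε i * (ε i * x i) ≤ 200 * (ε i * x i) := mul_le_mul_of_nonneg_right (ε1 i) b1
      have b5 : 0 ≤ ε i * (ε i * q i) := mul_nonneg (ε0 i) b3
      nlinarith)
  refine ⟨1000 * W, by positivity, fun i => ?_⟩
  have hWi : x i + y i + 2 * (ε i * q i) ≤ W := hW i
  have b3 : 0 ≤ ε i * q i := mul_nonneg (ε0 i) (q0 i)
  constructor
  · rw [sx]
    apply mul_le_mul_of_nonneg_right _ (pu i).le
    linarith [y0 i]
  · rw [zq']
    apply mul_le_mul_of_nonneg_right _ (pw (i+1)).le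
    have := r3 i
    have b4 : ε i * x i ≤ 200 * x i := mul_le_mul_of_nonneg_right (ε1 i) (x0 i)
    linarith [y0 i, x0 i]

lemma abs_lower (u w : ℕ → ℝ) (hu : ∀ i, 1/2 ≤ u i) (hw : ∀ i, 1/2 ≤ w i)
    (huw : ∀ i, 2 * u i ≤ w i) (hwu : ∀ i, 2 * w i ≤ u (i+1)) (s : ℕ → ℝ) (hs : ∀ i, 0 < s i)
    (h1 : ∀ i, (u i - 2) * s i ≤ s (i+1)) :
    ∃ m, 0 < m ∧ ∃ i₀, ∀ i, i₀ ≤ i → m * pr u i ≤ s i := by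
  have pu := pr_pos u hu
  obtain ⟨m, m0, i₀, h⟩ := pos_of_rec (fun i => s i / pr u i) 4 (by norm_num)
    (fun i => div_pos (hs i) (pu i)) (by
      intro i
      have eu : 1 ≤ 2 * (1/2)^i * u i := by
        have := u_ge u w hu hw huw hwu i
        rwa [div_le_iff₀ (by linarith [hu i])] at this
      rw [le_div_iff₀ (pu (i+1)), pr_succ]
      refine le_trans (le_of_eq ?_) (le_trans (mul_le_mul_of_nonneg_right
        (show u i - 4 * (1/2)^i * u i ≤ u i - 2 by linarith) (hs i).le) (h1 i))
      have := (pu i).ne'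
      field_simp)
  refine ⟨m, m0, i₀, fun i hi => ?_⟩
  have := h i hi
  rwa [le_div_iff₀ (pu i)] at this



/-! ### The products -/

lemma A_nonneg : ∀ i j, 0 ≤ Amat i j := by
  intro i j
  fin_cases i <;> fin_cases j <;> simp [Amat]

lemma M_nonneg : ∀ i j, 0 ≤ Mmat i j := by
  intro i j
  fin_cases i <;> fin_cases j <;> simp [Mmat]

lemma mul_nn {X Y : Matrix (Fin 9) (Fin 9) ℝ} (hX : ∀ i j, 0 ≤ X i j) (hY : ∀ i j, 0 ≤ Y i j) :
    ∀ i j, 0 ≤ (X * Y) i j := fun i j => by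
  rw [Matrix.mul_apply]
  exact Finset.sum_nonneg fun k _ => mul_nonneg (hX i k) (hY k j)

lemma one_nn : ∀ i j, 0 ≤ (1 : Matrix (Fin 9) (Fin 9) ℝ) i j := fun i j => by
  rw [Matrix.one_apply]; split_ifs <;> norm_num

lemma pow_nn {X : Matrix (Fin 9) (Fin 9) ℝ} (hX : ∀ i j, 0 ≤ X i j) (n : ℕ) :
    ∀ i j, 0 ≤ (X ^ n) i j := by
  induction n with
  | zero => rw [pow_zero]; exact one_nn
  | succ k ih => rw [pow_succ]; exact mul_nn ih hX

noncomputable def Qm (r : ℕ → ℕ) (i : ℕ) : Matrix (Fin 9) (Fin 9) ℝ :=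
  ((List.range i).map (fun l => Pmat r (2*l+1))).prod

lemma Qm_succ (r : ℕ → ℕ) (i : ℕ) : Qm r (i+1) = Qm r i * Pmat r (2*i+1) := by
  simp [Qm, List.range_succ]

lemma Qm_nonneg (r : ℕ → ℕ) (i : ℕ) : ∀ k j, 0 ≤ Qm r i k j := by
  induction i with
  | zero => simpa [Qm] using one_nn
  | succ k ih =>
    rw [Qm_succ]
    exact mul_nn ih (mul_nn (mul_nn (mul_nn (pow_nn A_nonneg _) M_nonneg) (pow_nn A_nonneg _))
      M_nonneg)

noncomputable def qv (r : ℕ → ℕ) (i : ℕ) : Fin 9 → ℝ := (fun _ => (1:ℝ)) ᵥ* Qm r i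

lemma qv_succ (r : ℕ → ℕ) (i : ℕ) : qv r (i+1) = qv r i ᵥ*
    (Amat ^ (aseq r (2*i+1)) * Mmat * Amat ^ (aseq r (2*i+2)) * Mmat) := by
  unfold qv
  rw [Qm_succ, ← Matrix.vecMul_vecMul]
  rfl

lemma qv_apply (r : ℕ → ℕ) (i : ℕ) (j : Fin 9) : qv r i j = ∑ k, Qm r i k j := by
  simp [qv, Matrix.vecMul, dotProduct]

lemma qv_nonneg (r : ℕ → ℕ) (i : ℕ) (j : Fin 9) : 0 ≤ qv r i j := by
  rw [qv_apply]
  exact Finset.sum_nonneg fun k _ => Qm_nonneg r i k j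

lemma eNorm_upper (x : Fin 9 → ℝ) (hx : ∀ k, 0 ≤ x k) : eNorm x ≤ ∑ k, x k := by
  unfold eNorm
  apply Real.sqrt_le_iff.mpr
  refine ⟨Finset.sum_nonneg fun k _ => hx k, ?_⟩
  exact Finset.sum_sq_le_sq_sum_of_nonneg fun k _ => hx k

lemma eNorm_lower (x : Fin 9 → ℝ) : (∑ k, x k) ≤ 3 * eNorm x := by
  have h := sq_sum_le_card_mul_sum_sq (s := (Finset.univ : Finset (Fin 9))) (f := x)
  have h2 : (∑ k, x k) ≤ Real.sqrt (9 * ∑ k, (x k)^2) := by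
    apply Real.le_sqrt_of_sq_le
    simpa using h
  rw [Real.sqrt_mul (by norm_num)] at h2
  have h3 : Real.sqrt 9 = 3 := by
    rw [show (9:ℝ) = 3 ^ 2 by norm_num]; exact Real.sqrt_sq (by norm_num)
  rw [h3] at h2
  exact h2

lemma col_bounds (r : ℕ → ℕ) (i : ℕ) (j : Fin 9) :
    eNorm ((Qm r i).mulVec (Pi.single j (1:ℝ))) ≤ qv r i j ∧
    qv r i j / 3 ≤ eNorm ((Qm r i).mulVec (Pi.single j (1:ℝ))) := by
  have e : (Qm r i).mulVec (Pi.single j (1:ℝ)) = fun k => Qm r i k j := by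
    ext k; simp
  rw [e, qv_apply]
  have h1 := eNorm_upper (fun k => Qm r i k j) (fun k => Qm_nonneg r i k j)
  have h2 := eNorm_lower (fun k => Qm r i k j)
  exact ⟨h1, by linarith⟩

lemma aseq_mono (r : ℕ → ℕ) (hr : GoodSeq r) (n : ℕ) (hn : 1 ≤ n) :
    aseq r n + 1 ≤ aseq r (n+1) := by
  obtain ⟨h1, h2, h3⟩ := hr
  have key : ∀ n, 1 ≤ n → 1 ≤ r n ∧ r n + 1 ≤ r (n+1) := by
    intro n hn
    induction n, hn using Nat.le_induction with
    | base => simp [h1, h2]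
    | succ k hk ih =>
      have := h3 k hk
      rw [show k + 1 + 1 = k + 2 from rfl]
      omega
  have := key n hn
  unfold aseq
  omega

lemma cseq_eq (r : ℕ → ℕ) (i : ℕ) : cseq r i = cq (aseq r i) := rfl

theorem stmt13 (r : ℕ → ℕ) (hr : GoodSeq r) :
    ∃ i₀ : ℕ, 1 ≤ i₀ ∧ ∃ c C : ℝ, 0 < c ∧ c ≤ C ∧
      ∀ i : ℕ, i₀ ≤ i →
        let Q := ((List.range i).map (fun l => Pmat r (2*l+1))).prod
        let ρ := (∏ l ∈ Finset.range i, cseq r (2*l+2)) / (∏ l ∈ Finset.range i, cseq r (2*l+1))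
        c * ρ ≤ eNorm (Q.mulVec (Pi.single (6 : Fin 9) (1 : ℝ)))
                  / eNorm (Q.mulVec (Pi.single (7 : Fin 9) (1 : ℝ))) ∧
        eNorm (Q.mulVec (Pi.single (6 : Fin 9) (1 : ℝ)))
            / eNorm (Q.mulVec (Pi.single (7 : Fin 9) (1 : ℝ))) ≤ C * ρ := by
  set u : ℕ → ℝ := fun l => cseq r (2*l+1) with hu_def
  set w : ℕ → ℝ := fun l => cseq r (2*l+2) with hw_def
  have hu : ∀ i, 1/2 ≤ u i := fun i => cq_ge _
  have hw : ∀ i, 1/2 ≤ w i := fun i => cq_ge _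
  have huw : ∀ i, 2 * u i ≤ w i := fun i => cq_mono (aseq_mono r hr (2*i+1) (by omega))
  have hwu : ∀ i, 2 * w i ≤ u (i+1) := fun i => cq_mono (aseq_mono r hr (2*i+2) (by omega))
  have hwu' : ∀ i, 2 * u i ≤ u (i+1) := fun i => by linarith [huw i, hwu i, hu i]
  have pu := pr_pos u hu
  have pw := pr_pos w hw
  have hq := qv_nonneg r
  have hp := phi_lo
  have q0 : qv r 0 = fun _ => (1:ℝ) := by simp [qv, Qm]
  have q7 : ∀ i, 1 ≤ qv r i 7 := by
    intro i
    induction i with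
    | zero => simp [q0]
    | succ k ih => rw [qv_succ]; exact ih.trans (seven_mono _ (hq k) _ _)
  have q2 : ∀ i, 1 ≤ qv r i 2 := by
    intro i
    induction i with
    | zero => simp [q0]
    | succ k ih => rw [qv_succ]; exact ih.trans (two_mono _ (hq k) _ _)
  have spos : ∀ i, 0 < sF (qv r i) := fun i => by
    have := mul_nonneg (show 0 ≤ goldphi by linarith) (hq i 8)
    unfold sF; linarith [q7 i]
  have tpos : ∀ i, 0 < tF (qv r i) := fun i => by
    have := mul_nonneg (show 0 ≤ goldphi by linarith) (hq i 1)
    unfold tF; linarith [q2 i]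
  have znn : ∀ i, 0 ≤ zF (qv r i) := fun i => by
    unfold zF; linarith [hq i 0, hq i 3, hq i 4, hq i 5, hq i 6]
  obtain ⟨W, W0, hW⟩ := abs_upper u w hu hw huw hwu (fun i => sF (qv r i)) (fun i => tF (qv r i))
    (fun i => zF (qv r i)) (fun i => (spos i).le) (fun i => (tpos i).le) znn
    (fun i => by simp only [qv_succ]; exact s_upper _ (hq i) _ _)
    (fun i => by simp only [qv_succ]; exact t_upper _ (hq i) _ _)
    (fun i => by simp only [qv_succ]; exact z_upper _ (hq i) _ _)
  obtain ⟨m1, m10, i1, hm1⟩ := abs_lower u w hu hw huw hwu (fun i => sF (qv r i)) spos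
    (fun i => by simp only [qv_succ]; exact s_lower _ (hq i) _ _)
  obtain ⟨m2, m20, i2, hm2⟩ := abs_lower w (fun i => u (i+1)) hw (fun i => hu _) hwu
    (fun i => huw (i+1)) (fun i => tF (qv r i)) tpos
    (fun i => by simp only [qv_succ]; exact t_lower _ (hq i) _ _)
  have ubig : ∀ i, 3 ≤ i → 4 ≤ u i := by
    intro i hi
    induction i, hi using Nat.le_induction with
    | base => linarith [hwu' 0, hwu' 1, hwu' 2, hu 0]
    | succ k hk ih => linarith [hwu' k]
  have key : ∀ j, i1 + i2 + 3 ≤ j →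
      m2 / 10 * pr w (j+1) ≤ qv r (j+1) 6 ∧ m1 / 10 * pr u (j+1) ≤ qv r (j+1) 7 := by
    intro j hj
    have hu4 := ubig j (by omega)
    have hw4 : 4 ≤ w j := by linarith [huw j]
    constructor
    · rw [qv_succ, pr_succ]
      refine le_trans ?_ (six_lower _ (hq j) _ _ hw4)
      have := mul_le_mul_of_nonneg_left (hm2 j (by omega)) (show 0 ≤ w j / 10 by linarith)
      refine le_trans (le_of_eq ?_) this
      ring
    · rw [qv_succ, pr_succ]
      refine le_trans ?_ (seven_lower _ (hq j) _ _ hu4)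
      have := mul_le_mul_of_nonneg_left (hm1 j (by omega)) (show 0 ≤ u j / 10 by linarith)
      refine le_trans (le_of_eq ?_) this
      ring
  have up6 : ∀ j, qv r (j+1) 6 ≤ W * pr w (j+1) := fun j => by
    have := (hW j).2
    refine le_trans ?_ this
    simp only [zF]; linarith [hq (j+1) 0, hq (j+1) 3, hq (j+1) 4, hq (j+1) 5]
  have up7 : ∀ j, qv r j 7 ≤ W * pr u j := fun j => by
    refine le_trans ?_ (hW j).1
    have := mul_nonneg (show 0 ≤ goldphi by linarith) (hq j 8)
    simp only [sF]; linarith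
  refine ⟨i1 + i2 + 4, by omega, m2 / (30 * W), max (m2 / (30 * W)) (30 * W / m1),
    by positivity, le_max_left _ _, ?_⟩
  intro i hi
  obtain ⟨j, rfl⟩ : ∃ j, i = j + 1 := ⟨i - 1, by omega⟩
  obtain ⟨k6, k7⟩ := key j (by omega)
  have c6 := col_bounds r (j+1) 6
  have c7 := col_bounds r (j+1) 7
  have g6 := up6 j
  have g7 := up7 (j+1)
  change m2 / (30 * W) * (pr w (j+1) / pr u (j+1)) ≤
      eNorm ((Qm r (j+1)).mulVec (Pi.single (6 : Fin 9) (1 : ℝ))) /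
      eNorm ((Qm r (j+1)).mulVec (Pi.single (7 : Fin 9) (1 : ℝ))) ∧
      eNorm ((Qm r (j+1)).mulVec (Pi.single (6 : Fin 9) (1 : ℝ))) /
      eNorm ((Qm r (j+1)).mulVec (Pi.single (7 : Fin 9) (1 : ℝ))) ≤
      max (m2 / (30 * W)) (30 * W / m1) * (pr w (j+1) / pr u (j+1))
  set N6 := eNorm ((Qm r (j+1)).mulVec (Pi.single (6 : Fin 9) (1 : ℝ)))
  set N7 := eNorm ((Qm r (j+1)).mulVec (Pi.single (7 : Fin 9) (1 : ℝ)))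
  have pU := pu (j+1)
  have pW := pw (j+1)
  set U := pr u (j+1)
  set V := pr w (j+1)
  have a7 : m1 / 30 * U ≤ N7 := by linarith
  have b7 : N7 ≤ W * U := by linarith
  have a6 : m2 / 30 * V ≤ N6 := by linarith
  have b6 : N6 ≤ W * V := by linarith
  have p7 : 0 < N7 := lt_of_lt_of_le (by positivity) a7
  constructor
  · calc m2 / (30 * W) * (V / U) = (m2 / 30 * V) / (W * U) := by field_simp
      _ ≤ N6 / N7 := div_le_div₀ (le_trans (by positivity) a6) a6 p7 b7
  · calc N6 / N7 ≤ (W * V) / (m1 / 30 * U) := div_le_div₀ (by positivity) b6 (by positivity) a7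
      _ = (30 * W / m1) * (V / U) := by field_simp
      _ ≤ _ := mul_le_mul_of_nonneg_right (le_max_right _ _) (by positivity)
end

section
/- The series ∑_{i=1}^∞ ‖R_i − L‖_F converges. -/
open Filter Finset Matrix

/-- Spectral component of `Amat`; `s = √5` and `s = -√5` give the two nontrivial ones. -/
noncomputable def specE (s : ℝ) : Matrix (Fin 9) (Fin 9) ℝ :=
  !![0,0,0,0,0,0,0,0,0;
     0,0,0,0,0,0,0,0,0;
     0,0,0,0,0,0,0,0,0;
     0,0,0,0,0,0,0,0,0;
     0,0,0,0,0,0,0,0,0;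
     0,0,0,0,0,0,0,0,0;
     0,0,0,0,0,0,0,0,0;
     0,0,0,(5-s)/10,(5-s)/10,(5+s)/10,(3*s-5)/10,(5-s)/10,s/5;
     0,0,0,s/5,s/5,(5+3*s)/10,(5-s)/10,s/5,(5+s)/10]

/-- Spectral component of `Amat` for the eigenvalue 1. -/
def specG : Matrix (Fin 9) (Fin 9) ℝ :=
  !![1,0,0,0,0,0,0,0,0;
     0,1,0,0,0,0,0,0,0;
     0,0,1,0,0,0,0,0,0;
     0,0,0,1,0,0,0,0,0;
     0,0,0,0,1,0,0,0,0;
     0,0,0,0,0,1,0,0,0;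
     0,0,0,0,0,0,1,0,0;
     0,0,0,-1,-1,-1,1,0,0;
     0,0,0,0,0,-1,-1,0,0]

lemma A_mul_E (s : ℝ) (hs : s * s = 5) : Amat * specE s = ((3 + s)/2) • specE s := by
  ext i j
  fin_cases i <;> fin_cases j <;>
    simp [Matrix.mul_apply, Fin.sum_univ_succ, Amat, specE] <;> linarith

lemma A_mul_G : Amat * specG = specG := by
  ext i j
  fin_cases i <;> fin_cases j <;>
    simp [Matrix.mul_apply, Fin.sum_univ_succ, Amat, specG] <;> norm_num

lemma sum_spec (s : ℝ) : specE s + specE (-s) + specG = 1 := by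
  ext i j
  fin_cases i <;> fin_cases j <;>
    simp [specE, specG, Matrix.one_apply] <;> ring

lemma E_M_E (s t : ℝ) : specE s * Mmat * specE t = 0 := by
  have h : Mmat * specE t = Matrix.of ![0, specE t 8, specE t 7, 0, 0, 0, 0, 0, 0] := by
    ext i j
    fin_cases i <;> fin_cases j <;>
      simp [Matrix.mul_apply, Fin.sum_univ_succ, Mmat, specE]
  rw [Matrix.mul_assoc, h]
  ext i j
  rw [Matrix.mul_apply]
  fin_cases i <;>
    simp [Fin.sum_univ_succ, specE]

set_option maxHeartbeats 4000000 in
lemma G_M_E_M (s : ℝ) (hs : s * s = 5) (h5 : s = Real.sqrt 5) :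
    specG * Mmat * specE s * Mmat = (2 / s) • Lmat := by
  have h0 : s ≠ 0 := by rintro rfl; norm_num at hs
  have h2 : (2 / s) = 2 * s / 5 := by
    rw [div_eq_div_iff h0 (by norm_num)]; linarith
  have h : Mmat * (specE s * Mmat) = (2 * s / 5) • Lmat := by
    ext i j
    rw [Matrix.mul_apply]
    fin_cases i <;> fin_cases j <;>
      simp [Matrix.mul_apply, Fin.sum_univ_succ, Mmat, specE, Lmat, ← h5] <;> linarith
  have h' : specG * Lmat = Lmat := by
    ext i j
    rw [Matrix.mul_apply]
    fin_cases i <;> fin_cases j <;>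
      simp [Fin.sum_univ_succ, specG, Lmat]
  rw [Matrix.mul_assoc, Matrix.mul_assoc, h, h2, Matrix.mul_smul, h']

lemma A_pow (s : ℝ) (hs : s * s = 5) (n : ℕ) :
    Amat ^ n = ((3 + s)/2)^n • specE s + ((3 - s)/2)^n • specE (-s) + specG := by
  induction n with
  | zero => simp [sum_spec]
  | succ n ih =>
    rw [pow_succ', ih, Matrix.mul_add, Matrix.mul_add, Matrix.mul_smul, Matrix.mul_smul,
      A_mul_E s hs, A_mul_E (-s) (by linarith), A_mul_G, smul_smul, smul_smul, pow_succ, pow_succ,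
      ← sub_eq_add_neg]

lemma P_expand (E F G M L : Matrix (Fin 9) (Fin 9) ℝ) (x x' y y' d : ℝ)
    (h1 : E * M * E = 0) (h2 : E * M * F = 0) (h3 : F * M * E = 0) (h4 : F * M * F = 0)
    (h5 : G * M * E * M = d • L) (hd : d ≠ 0) (hy : y * y' = 1) :
    (d * y)⁻¹ • ((x • E + x' • F + G) * M * (y • E + y' • F + G) * M) - L =
      (x * y') • (d⁻¹ • (E * M * G * M)) + (x' * y') • (d⁻¹ • (F * M * G * M))
      + y' • (d⁻¹ • (G * M * G * M)) + (y' * y') • (d⁻¹ • (G * M * F * M)) := by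
  have hy0 : y ≠ 0 := by rintro rfl; simp at hy
  have hy' : y' = y⁻¹ := by field_simp; linarith
  simp only [Matrix.add_mul, Matrix.mul_add, Matrix.smul_mul, Matrix.mul_smul, h1, h2, h3, h4, h5,
    smul_zero, Matrix.zero_mul, zero_add, add_zero, smul_add, smul_smul, hy']
  have e : (d * y)⁻¹ * (y * d) = 1 := by field_simp
  rw [e]
  match_scalars <;> field_simp <;> ring

section
attribute [local instance] Matrix.frobeniusNormedAddCommGroup Matrix.frobeniusNormedSpace

lemma frob_eq (X : Matrix (Fin 9) (Fin 9) ℝ) : frobNorm X = ‖X‖ := by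
  rw [Matrix.frobenius_norm_def, frobNorm, Real.sqrt_eq_rpow]
  simp

lemma frob_bound (X1 X2 X3 X4 : Matrix (Fin 9) (Fin 9) ℝ) : ∃ K : ℝ, ∀ (b1 b2 b3 b4 q : ℝ),
    |b1| ≤ q → |b2| ≤ q → |b3| ≤ q → |b4| ≤ q →
    frobNorm (b1 • X1 + b2 • X2 + b3 • X3 + b4 • X4) ≤ K * q := by
  refine ⟨‖X1‖ + ‖X2‖ + ‖X3‖ + ‖X4‖, fun b1 b2 b3 b4 q h1 h2 h3 h4 => ?_⟩
  rw [frob_eq]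
  have key : ∀ (b : ℝ) (X : Matrix (Fin 9) (Fin 9) ℝ), |b| ≤ q → ‖b • X‖ ≤ q * ‖X‖ := by
    intro b X hb
    rw [norm_smul, Real.norm_eq_abs]
    exact mul_le_mul_of_nonneg_right hb (norm_nonneg _)
  have n1 := norm_add_le (b1 • X1 + b2 • X2 + b3 • X3) (b4 • X4)
  have n2 := norm_add_le (b1 • X1 + b2 • X2) (b3 • X3)
  have n3 := norm_add_le (b1 • X1) (b2 • X2)
  linarith [key b1 X1 h1, key b2 X2 h2, key b3 X3 h3, key b4 X4 h4]
end

lemma r_growth (r : ℕ → ℕ) (hr : GoodSeq r) (n : ℕ) :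
    1 ≤ r (n+1) ∧ n + 1 ≤ r (n+2) - r (n+1) := by
  obtain ⟨h1, h2, h3⟩ := hr
  induction n with
  | zero => simp [h1, h2]
  | succ n ih =>
    have := h3 (n+1) (by omega)
    have e1 : n + 1 + 1 = n + 2 := rfl
    have e2 : n + 1 + 2 = n + 3 := rfl
    rw [e1, e2] at *
    omega

lemma a_growth (r : ℕ → ℕ) (hr : GoodSeq r) (n : ℕ) :
    aseq r (n+1) + (n + 1) ≤ aseq r (n+1+1) := by
  have h := r_growth r hr n
  have e1 : n + 1 + 1 = n + 2 := rfl
  unfold aseq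
  rw [e1]
  omega

/-- The series `∑_{i=1}^∞ ‖R_i − L‖_F` converges. -/
theorem stmt15 (r : ℕ → ℕ) (hr : GoodSeq r) :
    Summable (fun i : ℕ => frobNorm (Rmat r (i+1) - Lmat)) := by
  set s := Real.sqrt 5 with hsdef
  have hs : s * s = 5 := Real.mul_self_sqrt (by norm_num)
  have hs0 : 0 ≤ s := Real.sqrt_nonneg 5
  have hs2 : 2 < s := by nlinarith
  have hs3 : s < 3 := by nlinarith
  set q : ℝ := (3 - s)/2 with hq
  set p : ℝ := (3 + s)/2 with hp
  have hpq : p * q = 1 := by rw [hp, hq]; linarith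
  have hq0 : 0 < q := by rw [hq]; linarith
  have hq1 : q < 1 := by rw [hq]; linarith
  have hphi : goldphi ^ 2 = p := by
    rw [goldphi, ← hsdef, hp]; linarith
  obtain ⟨K, hK⟩ := frob_bound ((2/s)⁻¹ • (specE s * Mmat * specG * Mmat))
    ((2/s)⁻¹ • (specE (-s) * Mmat * specG * Mmat)) ((2/s)⁻¹ • (specG * Mmat * specG * Mmat))
    ((2/s)⁻¹ • (specG * Mmat * specE (-s) * Mmat))
  have hsum : Summable (fun i : ℕ => K * q ^ i) :=
    (summable_geometric_of_lt_one hq0.le hq1).mul_left K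
  refine Summable.of_nonneg_of_le (fun i => Real.sqrt_nonneg _) (fun i => ?_) hsum
  have ha := a_growth r hr i
  obtain ⟨d, hd⟩ := Nat.exists_eq_add_of_le ha
  have hle : ∀ m : ℕ, i ≤ m → |q ^ m| ≤ q ^ i := by
    intro m hm
    rw [abs_of_pos (pow_pos hq0 m)]
    exact pow_le_pow_of_le_one hq0.le hq1.le hm
  have hpqn : ∀ n : ℕ, p ^ n * q ^ n = 1 := fun n => by rw [← mul_pow, hpq, one_pow]
  rw [Rmat, Pmat, cseq, pow_mul, hphi, A_pow s hs, A_pow s hs, ← hsdef,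
    P_expand _ _ _ _ Lmat _ _ _ _ (2/s) (E_M_E _ _) (E_M_E _ _) (E_M_E _ _) (E_M_E _ _)
      (G_M_E_M s hs hsdef) (by positivity) (hpqn _)]
  apply hK
  · have : p ^ aseq r (i+1) * q ^ aseq r (i+1+1) = q ^ (i + 1 + d) := by
      rw [hd, add_assoc, pow_add, ← mul_assoc, hpqn, one_mul]
    rw [this]
    exact hle _ (by omega)
  · rw [← pow_add]; exact hle _ (by omega)
  · exact hle _ (by omega)
  · rw [← pow_add]; exact hle _ (by omega)
end
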